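/- Let n ≥ 3 and H̃ be the matrix indexed by edges of K_n with (i,j) entry the number of spanning trees of K_n containing edges i and j. Then exactly one eigenvalue of H̃ is positive and all others are negative; that is, the symmetric bilinear form defined by H̃ is Lorentzian (signature (1, C(n,2)−1)). -/

import Mathlib

namespace SimpleGraph

variable {V : Type*}

/-- If `y` is reachable from `x`, then after deletion of the edge `s(p, q)` one of `y`, `p`, `q`
is still reachable from `x`. -/
lemma Reachable.deleteEdges_singleton {G : SimpleGraph V} {x y : V} (h : G.Reachable x y)
    (p q : V) :
    (G.deleteEdges {s(p, q)}).Reachable x y ∨ (G.deleteEdges {s(p, q)}).Reachable x p ∨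
      (G.deleteEdges {s(p, q)}).Reachable x q := by
  obtain ⟨W⟩ := h
  induction W with
  | nil => exact .inl .rfl
  | @cons a b c hab _ ih =>
    by_cases he : s(a, b) = s(p, q)
    · rcases Sym2.eq_iff.mp he with ⟨rfl, rfl⟩ | ⟨rfl, rfl⟩
      · exact .inr (.inl .rfl)
      · exact .inr (.inr .rfl)
    · have hr : (G.deleteEdges {s(p, q)}).Reachable a b :=
        Adj.reachable ((deleteEdges_adj ..).mpr ⟨hab, he⟩)
      exact ih.imp hr.trans (Or.imp hr.trans hr.trans)

lemma Connected.reachable_deleteEdges_or {G : SimpleGraph V} (hG : G.Connected) (p q x : V) :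
    (G.deleteEdges {s(p, q)}).Reachable p x ∨ (G.deleteEdges {s(p, q)}).Reachable q x := by
  rcases (hG.preconnected x p).deleteEdges_singleton p q with h | h | h
  exacts [.inl h.symm, .inl h.symm, .inr h.symm]

lemma IsTree.not_reachable_deleteEdges {T : SimpleGraph V} (hT : T.IsTree) {p q : V}
    (h : T.Adj p q) : ¬ (T.deleteEdges {s(p, q)}).Reachable p q :=
  isBridge_iff.mp (isAcyclic_iff_forall_adj_isBridge.mp hT.isAcyclic h)

/-- Replacing the edge `s(w, p)` of a tree by `s(w, q)` gives a tree if `q` lies on the side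
of `p`. -/
lemma IsTree.exchange {T : SimpleGraph V} (hT : T.IsTree) {w p q : V} (hwp : T.Adj w p)
    (hwq : w ≠ q) (hpq : (T.deleteEdges {s(w, p)}).Reachable p q) :
    (T.deleteEdges {s(w, p)} ⊔ edge w q).IsTree := by
  have hle : T.deleteEdges {s(w, p)} ≤ T.deleteEdges {s(w, p)} ⊔ edge w q := le_sup_left
  have hr : ∀ x, (T.deleteEdges {s(w, p)} ⊔ edge w q).Reachable w x := by
    intro x
    rcases hT.connected.reachable_deleteEdges_or w p x with h | h
    · exact h.mono hle
    · have hadj : (T.deleteEdges {s(w, p)} ⊔ edge w q).Adj w q := by simp [edge_adj, hwq]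
      exact hadj.reachable.trans ((hpq.symm.trans h).mono hle)
  have := hT.connected.nonempty
  refine ⟨⟨fun x y ↦ (hr x).symm.trans (hr y)⟩, ?_⟩
  exact (hT.isAcyclic.anti (deleteEdges_le _)).sup_edge_of_not_reachable
    fun h ↦ hT.not_reachable_deleteEdges hwp (h.trans hpq.symm)

/-- The trees that contain the edges `s(u, v)` and `s(w, p)`. -/
def treesThrough (u v w p : V) : Set (SimpleGraph V) :=
  {T | T.IsTree ∧ T.Adj u v ∧ T.Adj w p}

/-- The trees that contain the edges `s(u, v)` and `s(w, p)` and in which `q` lies on the side of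
`p` after deletion of `s(w, p)`. -/
def treesBeyond (u v w p q : V) : Set (SimpleGraph V) :=
  {T | T ∈ treesThrough u v w p ∧ (T.deleteEdges {s(w, p)}).Reachable p q}

lemma comap_deleteEdges_singleton (T : SimpleGraph V) (σ : Equiv.Perm V) (a b : V) :
    (T.comap σ).deleteEdges {s(a, b)} = (T.deleteEdges {s(σ a, σ b)}).comap σ := by
  ext x y
  simp [deleteEdges_adj]

lemma comap_mem_treesThrough {T : SimpleGraph V} (σ : Equiv.Perm V) {u v w p : V}
    (h : T ∈ treesThrough (σ u) (σ v) (σ w) (σ p)) : T.comap σ ∈ treesThrough u v w p :=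
  ⟨(Iso.comap σ T).isTree_iff.mpr h.1, h.2⟩

lemma comap_mem_treesBeyond {T : SimpleGraph V} (σ : Equiv.Perm V) {u v w p q : V}
    (h : T ∈ treesBeyond (σ u) (σ v) (σ w) (σ p) (σ q)) : T.comap σ ∈ treesBeyond u v w p q := by
  refine ⟨comap_mem_treesThrough σ h.1, ?_⟩
  rw [comap_deleteEdges_singleton]
  exact (Iso.comap σ _).reachable_iff.mp h.2

lemma comap_perm_injective (σ : Equiv.Perm V) :
    Function.Injective fun T : SimpleGraph V ↦ T.comap σ := by
  intro T T' h
  ext x y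
  simpa using congrArg (fun G : SimpleGraph V ↦ G.Adj (σ.symm x) (σ.symm y)) h

variable [Finite V]

lemma ncard_treesThrough_perm (σ : Equiv.Perm V) (u v w p : V) :
    (treesThrough (σ u) (σ v) (σ w) (σ p)).ncard = (treesThrough u v w p).ncard := by
  refine le_antisymm ?_ ?_
  · exact Set.ncard_le_ncard_of_injOn _ (fun T hT ↦ comap_mem_treesThrough σ hT)
      (comap_perm_injective σ).injOn
  · refine Set.ncard_le_ncard_of_injOn (fun T ↦ T.comap (σ.symm : Equiv.Perm V))
      (fun T hT ↦ comap_mem_treesThrough σ.symm ?_) (comap_perm_injective σ.symm).injOn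
    simpa using hT

lemma ncard_treesThrough_eq_add {u v w p : V} (q : V) :
    (treesThrough u v w p).ncard = (treesBeyond u v w p q).ncard + (treesBeyond u v p w q).ncard := by
  rw [← Set.ncard_union_eq]
  · congr 1
    ext T
    constructor
    · intro h
      rcases h.1.connected.reachable_deleteEdges_or w p q with h' | h'
      · exact .inr ⟨⟨h.1, h.2.1, h.2.2.symm⟩, by rwa [Sym2.eq_swap]⟩
      · exact .inl ⟨h, h'⟩
    · rintro (h | h)
      · exact h.1
      · exact ⟨h.1.1, h.1.2.1, h.1.2.2.symm⟩
  · refine Set.disjoint_left.mpr fun T h h' ↦ h.1.1.not_reachable_deleteEdges h.1.2.2 ?_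
    have h2 := h'.2
    rw [Sym2.eq_swap] at h2
    exact h2.trans h.2.symm

lemma ncard_treesBeyond_le_of_exchange {u v w p q : V} (he : s(u, v) ≠ s(w, p)) (hwq : w ≠ q)
    (hpq : p ≠ q) : (treesBeyond u v w p q).ncard ≤ (treesBeyond u v w q p).ncard := by
  have hdel : ∀ T ∈ treesBeyond u v w p q,
      (T.deleteEdges {s(w, p)} ⊔ edge w q).deleteEdges {s(w, q)} = T.deleteEdges {s(w, p)} := by
    intro T hT
    have hn : ¬ T.Adj w q := fun h ↦ hT.1.1.not_reachable_deleteEdges hT.1.2.2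
      ((Adj.reachable (by simp [h, hpq.symm, hwq.symm])).trans hT.2.symm)
    ext x y
    simp only [deleteEdges_adj, sup_adj, edge_adj, Set.mem_singleton_iff, Sym2.eq_iff]
    constructor
    · tauto
    · rintro ⟨h1, h2⟩
      refine ⟨.inl ⟨h1, h2⟩, ?_⟩
      rintro (⟨rfl, rfl⟩ | ⟨rfl, rfl⟩)
      exacts [hn h1, hn h1.symm]
  refine Set.ncard_le_ncard_of_injOn (fun T ↦ T.deleteEdges {s(w, p)} ⊔ edge w q) ?_ ?_
  · intro T hT
    refine ⟨⟨hT.1.1.exchange hT.1.2.2 hwq hT.2, .inl ?_, .inr ?_⟩, ?_⟩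
    · exact (deleteEdges_adj ..).mpr ⟨hT.1.2.1, he⟩
    · simp [edge_adj, hwq]
    · rw [hdel T hT]
      exact hT.2.symm
  · intro T hT T' hT' h
    have hd : T.deleteEdges {s(w, p)} = T'.deleteEdges {s(w, p)} := by
      rw [← hdel T hT, ← hdel T' hT']
      exact congrArg (fun G ↦ deleteEdges G {s(w, q)}) h
    ext x y
    by_cases hxy : s(x, y) = s(w, p)
    · rw [← mem_edgeSet, ← mem_edgeSet, hxy]
      exact iff_of_true hT.1.2.2 hT'.1.2.2
    · have : (T.deleteEdges {s(w, p)}).Adj x y ↔ (T'.deleteEdges {s(w, p)}).Adj x y := by rw [hd]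
      simpa only [deleteEdges_adj, Set.mem_singleton_iff, hxy, not_false_eq_true, and_true]
        using this

/-- If `q` hangs off `w` in trees through the path `u, v, w`, swapping `u` and `w` makes it hang
off `u` or `v`. -/
lemma ncard_treesBeyond_leaf_le {u v w x : V} (huv : u ≠ v) (huw : u ≠ w) (hvw : v ≠ w)
    (hux : u ≠ x) (hwx : w ≠ x) :
    (treesBeyond u v v w x).ncard ≤ (treesBeyond u v w v x).ncard := by
  classical
  refine Set.ncard_le_ncard_of_injOn (fun T ↦ T.comap (Equiv.swap u w)) (fun T hT ↦ ?_)
    (comap_perm_injective _).injOn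
  have hmem : T.comap (Equiv.swap u w) ∈ treesBeyond w v v u x := by
    apply comap_mem_treesBeyond
    rwa [Equiv.swap_apply_left, Equiv.swap_apply_right, Equiv.swap_apply_of_ne_of_ne huv.symm hvw,
      Equiv.swap_apply_of_ne_of_ne hux.symm hwx.symm]
  obtain ⟨⟨htree, hwv, hvu⟩, hux'⟩ := hmem
  set S := T.comap (Equiv.swap u w)
  refine ⟨⟨htree, hvu.symm, hwv⟩, ?_⟩
  have hvu' : (S.deleteEdges {s(w, v)}).Reachable v u :=
    Adj.reachable (by simp [hvu, hvw, huw])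
  have hvw' : (S.deleteEdges {s(v, u)}).Reachable w v :=
    Adj.reachable (by simp [hwv, hvw.symm, huw.symm])
  have hle : (S.deleteEdges {s(v, u)}).deleteEdges {s(w, v)} ≤ S.deleteEdges {s(w, v)} :=
    deleteEdges_mono (deleteEdges_le _)
  rcases hux'.symm.deleteEdges_singleton w v with h | h | h
  · exact hvu'.trans (h.mono hle).symm
  · exact absurd (hux'.trans ((h.mono (deleteEdges_le _)).trans hvw')).symm
      (htree.not_reachable_deleteEdges hvu)
  · exact (h.mono hle).symm

lemma ncard_treesBeyond_leaf_pos {u v w x : V} (huv : u ≠ v) (hvw : v ≠ w) (hvx : v ≠ x)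
    (hux : u ≠ x) (hwx : w ≠ x) : 0 < (treesBeyond u v v w x).ncard := by
  have hstar : starGraph v ∈ treesBeyond u v x v w := by
    refine ⟨⟨isTree_starGraph v, by simp [huv], by simp [hvx.symm]⟩, Adj.reachable ?_⟩
    simp [hvw, hvx, hwx]
  refine (Set.ncard_pos (Set.toFinite _)).mpr
    ⟨(starGraph v).deleteEdges {s(x, v)} ⊔ edge x w,
      ⟨hstar.1.1.exchange hstar.1.2.2 hwx.symm hstar.2, .inl ?_, .inl ?_⟩, Adj.reachable ?_⟩
  · simp [huv, hux, hvx]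
  · simp [hvw, hvx, hwx]
  · simp [edge_adj, hwx, hvx.symm, hvw.symm]

lemma ncard_treesThrough_adjacent_disjoint {u v w x : V} (huv : u ≠ v) (huw : u ≠ w) (hux : u ≠ x)
    (hvw : v ≠ w) (hvx : v ≠ x) (hwx : w ≠ x) :
    (treesThrough u v w v).ncard ≤ (treesThrough u v w x).ncard ∧
      (treesThrough u v w x).ncard < 2 * (treesThrough u v w v).ncard := by
  classical
  have hA := ncard_treesThrough_eq_add (u := u) (v := v) (w := w) (p := v) x
  have hB := ncard_treesThrough_eq_add (u := u) (v := v) (w := w) (p := x) v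
  have hE : (treesBeyond u v w x v).ncard = (treesBeyond u v w v x).ncard :=
    le_antisymm
      (ncard_treesBeyond_le_of_exchange (by simp [huw, hux]) hvw.symm hvx.symm)
      (ncard_treesBeyond_le_of_exchange (by simp [huw, huv]) hwx hvx)
  have hS : ∀ {y z : V}, u ≠ y → u ≠ z → v ≠ y → v ≠ z →
      (treesBeyond u v y z v).ncard ≤ (treesBeyond u v z y v).ncard := by
    intro y z huy huz hvy hvz
    refine Set.ncard_le_ncard_of_injOn (fun T ↦ T.comap (Equiv.swap y z)) (fun T hT ↦ ?_)
      (comap_perm_injective _).injOn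
    apply comap_mem_treesBeyond
    rwa [Equiv.swap_apply_left, Equiv.swap_apply_right, Equiv.swap_apply_of_ne_of_ne huy huz,
      Equiv.swap_apply_of_ne_of_ne hvy hvz]
  have h1 := hS huw hux hvw hvx
  have h2 := hS hux huw hvx hvw
  have h3 := ncard_treesBeyond_leaf_le huv huw hvw hux hwx
  have h4 := ncard_treesBeyond_leaf_pos huv hvw hvx hux hwx
  omega

lemma ncard_treesThrough_eq_of_embedding {k : ℕ} (x y : Fin k ↪ V) (i j l m : Fin k) :
    (treesThrough (x i) (x j) (x l) (x m)).ncard =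
      (treesThrough (y i) (y j) (y l) (y m)).ncard := by
  obtain ⟨σ, hσ⟩ := (Equiv.Perm.isMultiplyPretransitive V k).exists_smul_eq y x
  rw [← hσ]
  exact ncard_treesThrough_perm σ _ _ _ _

lemma exists_ncard_treesThrough {u₀ v₀ w₀ : V} (huv₀ : u₀ ≠ v₀) (huw₀ : u₀ ≠ w₀)
    (hvw₀ : v₀ ≠ w₀) :
    ∃ a b : ℕ, 0 < a ∧ a ≤ b ∧ b < 2 * a ∧
      (∀ u v w : V, u ≠ v → u ≠ w → v ≠ w → (treesThrough u v w v).ncard = a) ∧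
      ∀ u v w x : V, u ≠ v → u ≠ w → u ≠ x → v ≠ w → v ≠ x → w ≠ x →
        (treesThrough u v w x).ncard = b := by
  set a := (treesThrough u₀ v₀ w₀ v₀).ncard with ha
  have hinj₃ : ∀ u v w : V, u ≠ v → u ≠ w → v ≠ w → Function.Injective ![u, v, w] := by
    intro u v w _ _ _ i j h
    fin_cases i <;> fin_cases j <;> simp_all
  have hinj₄ : ∀ u v w x : V, u ≠ v → u ≠ w → u ≠ x → v ≠ w → v ≠ x → w ≠ x →
      Function.Injective ![u, v, w, x] := by
    intro u v w x _ _ _ _ _ _ i j h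
    fin_cases i <;> fin_cases j <;> simp_all
  have hadj : ∀ u v w : V, u ≠ v → u ≠ w → v ≠ w → (treesThrough u v w v).ncard = a :=
    fun u v w huv huw hvw ↦ ncard_treesThrough_eq_of_embedding
      ⟨_, hinj₃ u v w huv huw hvw⟩ ⟨_, hinj₃ u₀ v₀ w₀ huv₀ huw₀ hvw₀⟩ 0 1 2 1
  have hpos : 0 < a := (Set.ncard_pos (Set.toFinite _)).mpr
    ⟨starGraph v₀, isTree_starGraph _, by simp [huv₀], by simp [hvw₀.symm]⟩
  by_cases h : Nonempty (Fin 4 ↪ V)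
  · obtain ⟨y⟩ := h
    have hne : ∀ i j, i ≠ j → y i ≠ y j := fun i j h ↦ y.injective.ne h
    have hy := ncard_treesThrough_adjacent_disjoint (hne 0 1 (by decide)) (hne 0 2 (by decide))
      (hne 0 3 (by decide)) (hne 1 2 (by decide)) (hne 1 3 (by decide)) (hne 2 3 (by decide))
    rw [hadj _ _ _ (hne 0 1 (by decide)) (hne 0 2 (by decide)) (hne 1 2 (by decide))] at hy
    refine ⟨a, _, hpos, hy.1, hy.2, hadj, fun u v w x huv huw hux hvw hvx hwx ↦ ?_⟩
    exact ncard_treesThrough_eq_of_embedding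
      ⟨_, hinj₄ u v w x huv huw hux hvw hvx hwx⟩ y 0 1 2 3
  · refine ⟨a, a, hpos, le_rfl, by omega, hadj, fun u v w x huv huw hux hvw hvx hwx ↦ ?_⟩
    exact absurd ⟨⟨_, hinj₄ u v w x huv huw hux hvw hvx hwx⟩⟩ h

end SimpleGraph

namespace Matrix

variable {ι : Type*} [Fintype ι] [DecidableEq ι] {A : Matrix ι ι ℝ}

lemma IsHermitian.dotProduct_mulVec_eigenvectorUnitary (hA : A.IsHermitian) (c : ι → ℝ) :
    (hA.eigenvectorUnitary : Matrix ι ι ℝ) *ᵥ c ⬝ᵥ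
        A *ᵥ ((hA.eigenvectorUnitary : Matrix ι ι ℝ) *ᵥ c) =
      ∑ i, hA.eigenvalues i * c i ^ 2 := by
  set U : Matrix ι ι ℝ := hA.eigenvectorUnitary.1 with hU
  have hUU : Uᵀ * U = 1 := Unitary.coe_star_mul_self hA.eigenvectorUnitary
  have hAU : A * U = U * diagonal hA.eigenvalues := by
    ext e i
    have := congrFun (hA.mulVec_eigenvectorBasis i) e
    rw [mul_diagonal]
    simpa [hU, mul_apply, mulVec, dotProduct, mul_comm] using this
  rw [mulVec_mulVec, hAU, ← mulVec_mulVec, dotProduct_mulVec, ← mulVec_transpose, mulVec_mulVec,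
    hUU, one_mulVec, dotProduct]
  exact Finset.sum_congr rfl fun i _ ↦ by rw [mulVec_diagonal]; ring

/-- A real symmetric matrix which is negative definite on the kernel of a linear functional and
takes a positive value has exactly one positive eigenvalue, and the others are negative. -/
lemma IsHermitian.ncard_eigenvalues_of_lorentzian (hA : A.IsHermitian) (ℓ : (ι → ℝ) →ₗ[ℝ] ℝ)
    (hneg : ∀ x, x ≠ 0 → ℓ x = 0 → x ⬝ᵥ A *ᵥ x < 0) {y : ι → ℝ} (hy : 0 < y ⬝ᵥ A *ᵥ y) :
    {i | 0 < hA.eigenvalues i}.ncard = 1 ∧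
      {i | hA.eigenvalues i < 0}.ncard = Fintype.card ι - 1 := by
  set U : Matrix ι ι ℝ := hA.eigenvectorUnitary.1 with hU
  have hUU : Uᵀ * U = 1 := Unitary.coe_star_mul_self hA.eigenvectorUnitary
  have hUU' : U * Uᵀ = 1 := Unitary.coe_mul_star_self hA.eigenvectorUnitary
  have hform := hA.dotProduct_mulVec_eigenvectorUnitary
  rw [← hU] at hform
  obtain ⟨i, hi⟩ : ∃ i, 0 < hA.eigenvalues i := by
    by_contra! h
    have hy' := hform (Uᵀ *ᵥ y)
    rw [mulVec_mulVec, hUU', one_mulVec] at hy'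
    exact (hy.trans_eq hy').not_ge
      (Finset.sum_nonpos fun i _ ↦ mul_nonpos_of_nonpos_of_nonneg (h i) (sq_nonneg _))
  have hker : ∀ c : ι → ℝ, c ≠ 0 → ℓ (U *ᵥ c) = 0 → ∃ k, c k ≠ 0 ∧ hA.eigenvalues k < 0 := by
    intro c hc hℓ
    by_contra! h
    refine (hneg (U *ᵥ c) (fun h0 ↦ hc ?_) hℓ).not_ge ?_
    · rw [← one_mulVec c, ← hUU, ← mulVec_mulVec, h0, mulVec_zero]
    · rw [hform]
      refine Finset.sum_nonneg fun k _ ↦ ?_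
      by_cases hk : c k = 0
      · simp [hk]
      · exact mul_nonneg (h k hk) (sq_nonneg _)
  have hsingle : ℓ (U *ᵥ Pi.single i 1) ≠ 0 := by
    intro h
    obtain ⟨k, hk, hk'⟩ := hker (Pi.single i 1) (by simp) h
    rcases eq_or_ne k i with rfl | hki
    · exact hk'.not_gt hi
    · exact hk (Pi.single_eq_of_ne hki _)
  have hother : ∀ j, j ≠ i → hA.eigenvalues j < 0 := by
    intro j hj
    set s := ℓ (U *ᵥ Pi.single i 1)
    set t := ℓ (U *ᵥ Pi.single j 1)
    obtain ⟨k, hk, hk'⟩ := hker (s • Pi.single j 1 - t • Pi.single i 1)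
      (fun h ↦ hsingle (by simpa [hj] using congrFun h j))
      (by rw [mulVec_sub, mulVec_smul, mulVec_smul, map_sub, map_smul, map_smul, smul_eq_mul,
        smul_eq_mul, mul_comm, sub_self])
    by_cases hkj : k = j
    · exact hkj ▸ hk'
    by_cases hki : k = i
    · exact absurd hi (hki ▸ hk').not_gt
    · simp [hkj, hki] at hk
  have hset : {j | 0 < hA.eigenvalues j} = {i} := by
    ext j
    refine ⟨fun h ↦ ?_, fun h ↦ by rwa [Set.mem_singleton_iff.mp h]⟩
    by_contra hj
    exact (hother j hj).not_gt h
  have hset' : {j | hA.eigenvalues j < 0} = {i}ᶜ := by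
    ext j
    exact ⟨fun h hj ↦ hi.not_gt ((Set.mem_singleton_iff.mp hj) ▸ h), hother j⟩
  rw [hset, hset', Set.ncard_compl, Set.ncard_singleton, Nat.card_eq_fintype_card]
  exact ⟨rfl, rfl⟩

end Matrix

section EdgePairs

open scoped Matrix

/-- The matrix indexed by the edges of the complete graph whose off-diagonal entries count the
spanning trees through two edges, and whose diagonal vanishes. -/
noncomputable def spanningTreePairMatrix (V : Type*) [DecidableEq V] :
    Matrix {e : Sym2 V // ¬ e.IsDiag} {e : Sym2 V // ¬ e.IsDiag} ℝ :=
  Matrix.of fun e f => if e = f then 0 else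
    ({T : SimpleGraph V | T.IsTree ∧ e.1 ∈ T.edgeSet ∧ f.1 ∈ T.edgeSet}.ncard : ℝ)

/-- The vertex-edge incidence matrix of the complete graph. -/
def completeIncMatrix (V : Type*) [DecidableEq V] : Matrix V {e : Sym2 V // ¬ e.IsDiag} ℝ :=
  Matrix.of fun v e => if v ∈ e.1 then 1 else 0

lemma spanningTreePairMatrix_isHermitian {V : Type*} [DecidableEq V] :
    (spanningTreePairMatrix V).IsHermitian := by
  ext e f
  simp only [spanningTreePairMatrix, Matrix.conjTranspose_apply, Matrix.of_apply, star_trivial]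
  simp only [eq_comm (a := f), and_comm (a := f.1 ∈ _)]

variable {V : Type*} [Fintype V] [DecidableEq V]

lemma completeIncMatrix_transpose_mul_self_apply (e f : {e : Sym2 V // ¬ e.IsDiag}) :
    ((completeIncMatrix V)ᵀ * completeIncMatrix V) e f =
      ({v | v ∈ e.1 ∧ v ∈ f.1} : Finset V).card := by
  rw [← Finset.sum_boole, Matrix.mul_apply]
  refine Finset.sum_congr rfl fun v _ ↦ ?_
  by_cases he : v ∈ e.1 <;> by_cases hf : v ∈ f.1 <;> simp [completeIncMatrix, he, hf]

open SimpleGraph in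
lemma spanningTreePairMatrix_eq {a b : ℕ}
    (hadj : ∀ u v w : V, u ≠ v → u ≠ w → v ≠ w → (treesThrough u v w v).ncard = a)
    (hdisj : ∀ u v w x : V, u ≠ v → u ≠ w → u ≠ x → v ≠ w → v ≠ x → w ≠ x →
      (treesThrough u v w x).ncard = b) :
    spanningTreePairMatrix V = (b : ℝ) • Matrix.vecMulVec 1 1 -
      (b - a : ℝ) • ((completeIncMatrix V)ᵀ * completeIncMatrix V) - (2 * a - b : ℝ) • 1 := by
  ext e f
  simp only [Matrix.sub_apply, Matrix.smul_apply, completeIncMatrix_transpose_mul_self_apply,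
    Matrix.vecMulVec_apply, Pi.one_apply, smul_eq_mul, mul_one]
  obtain ⟨e, he⟩ := e
  induction e with | h u v => ?_
  have huv : u ≠ v := he
  by_cases hef : ⟨s(u, v), he⟩ = f
  · subst hef
    have hfil : ({y | y ∈ s(u, v) ∧ y ∈ s(u, v)} : Finset V) = {u, v} := by ext; simp
    rw [hfil, Finset.card_pair huv]
    simp [spanningTreePairMatrix]
    ring
  rw [Matrix.one_apply_ne hef]
  obtain ⟨f, hf⟩ := f
  have hM : spanningTreePairMatrix V ⟨s(u, v), he⟩ ⟨f, hf⟩ =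
      ({T : SimpleGraph V | T.IsTree ∧ s(u, v) ∈ T.edgeSet ∧ f ∈ T.edgeSet}.ncard : ℝ) :=
    if_neg hef
  have hef' : s(u, v) ≠ f := fun h ↦ hef (Subtype.ext h)
  rw [hM]
  by_cases hcom : ∃ y, y ∈ s(u, v) ∧ y ∈ f
  · obtain ⟨y, hye, hyf⟩ := hcom
    obtain ⟨p, hp⟩ := hye
    obtain ⟨q, rfl⟩ := hyf
    have hpy : p ≠ y := by
      rintro rfl
      simp [hp] at he
    have hqy : q ≠ y := by
      rintro rfl
      exact hf rfl
    have hpq : p ≠ q := by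
      rintro rfl
      exact hef' hp
    have hfil : ({z | z ∈ s(u, v) ∧ z ∈ s(y, q)} : Finset V) = {y} := by
      ext z
      simp only [hp, Sym2.mem_iff, Finset.mem_filter, Finset.mem_univ, true_and,
        Finset.mem_singleton]
      grind
    rw [hfil, Finset.card_singleton]
    have : {T : SimpleGraph V | T.IsTree ∧ s(p, y) ∈ T.edgeSet ∧ s(q, y) ∈ T.edgeSet}.ncard = a :=
      hadj p y q hpy hpq hqy.symm
    rw [hp, Sym2.eq_swap (a := y) (b := p), Sym2.eq_swap (a := y) (b := q)]
    rw [this]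
    ring
  · have hfil : ({z | z ∈ s(u, v) ∧ z ∈ f} : Finset V) = ∅ := by
      ext z
      simpa using fun h h' ↦ hcom ⟨z, by simpa using h, h'⟩
    rw [hfil, Finset.card_empty]
    induction f with | h w x => ?_
    have hwx : w ≠ x := hf
    push Not at hcom
    have hu := hcom u (by simp)
    have hv := hcom v (by simp)
    have : {T : SimpleGraph V | T.IsTree ∧ s(u, v) ∈ T.edgeSet ∧ s(w, x) ∈ T.edgeSet}.ncard = b :=
      hdisj u v w x huv (fun h ↦ hu (by simp [h])) (fun h ↦ hu (by simp [h]))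
        (fun h ↦ hv (by simp [h])) (fun h ↦ hv (by simp [h])) hwx
    rw [this]
    ring

lemma spanningTreePairMatrix_lorentzian (h3 : 2 < Fintype.card V) :
    {i | 0 < (spanningTreePairMatrix_isHermitian (V := V)).eigenvalues i}.ncard = 1 ∧
      {i | (spanningTreePairMatrix_isHermitian (V := V)).eigenvalues i < 0}.ncard =
        (Fintype.card V).choose 2 - 1 := by
  obtain ⟨u, v, w, huv, huw, hvw⟩ := Fintype.two_lt_card_iff.mp h3
  obtain ⟨a, b, ha, hab, hba, hadj, hdisj⟩ :=
    SimpleGraph.exists_ncard_treesThrough huv huw hvw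
  have hM := spanningTreePairMatrix_eq hadj hdisj
  have hab' : (a : ℝ) ≤ b := by exact_mod_cast hab
  have hba' : (b : ℝ) < 2 * a := by exact_mod_cast hba
  rw [← Sym2.card_subtype_not_diag]
  refine Matrix.IsHermitian.ncard_eigenvalues_of_lorentzian _ (∑ e, LinearMap.proj e)
    (fun x hx hsum ↦ ?_) (y := 1) ?_
  · have hsum' : (1 : {e : Sym2 V // ¬ e.IsDiag} → ℝ) ⬝ᵥ x = 0 := by
      simpa [dotProduct] using hsum
    have hxx : 0 < x ⬝ᵥ x := by
      simpa using Matrix.dotProduct_star_self_pos_iff.mpr hx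
    have hBx : 0 ≤ (completeIncMatrix V *ᵥ x) ⬝ᵥ (completeIncMatrix V *ᵥ x) := by
      exact Finset.sum_nonneg fun v _ ↦ mul_self_nonneg _
    rw [hM, Matrix.sub_mulVec, Matrix.sub_mulVec, Matrix.smul_mulVec, Matrix.smul_mulVec,
      Matrix.smul_mulVec, Matrix.vecMulVec_mulVec, hsum', Matrix.one_mulVec, ← Matrix.mulVec_mulVec]
    have hB : x ⬝ᵥ (completeIncMatrix V)ᵀ *ᵥ (completeIncMatrix V *ᵥ x) =
        (completeIncMatrix V *ᵥ x) ⬝ᵥ (completeIncMatrix V *ᵥ x) := by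
      rw [Matrix.dotProduct_mulVec, Matrix.vecMul_transpose]
    simp only [dotProduct_sub, dotProduct_smul, hB, smul_eq_mul, MulOpposite.op_zero, zero_smul,
      smul_zero, dotProduct_zero]
    nlinarith
  · have hnonneg : ∀ e f, 0 ≤ spanningTreePairMatrix V e f := by
      intro e f
      simp only [spanningTreePairMatrix, Matrix.of_apply]
      split_ifs <;> positivity
    simp only [Matrix.mulVec, dotProduct, Pi.one_apply, one_mul, mul_one]
    have he : ¬ (s(u, v)).IsDiag := huv
    have hf : ¬ (s(w, v)).IsDiag := hvw.symm
    have hne : (⟨s(u, v), he⟩ : {e : Sym2 V // ¬ e.IsDiag}) ≠ ⟨s(w, v), hf⟩ := by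
      simp [Subtype.ext_iff, huw, huv]
    have hval : spanningTreePairMatrix V ⟨s(u, v), he⟩ ⟨s(w, v), hf⟩ = a := by
      rw [← hadj u v w huv huw hvw]
      exact if_neg hne
    refine Finset.sum_pos' (fun e _ ↦ Finset.sum_nonneg fun f _ ↦ hnonneg e f)
      ⟨⟨s(u, v), he⟩, Finset.mem_univ _, Finset.sum_pos' (fun f _ ↦ hnonneg _ f)
        ⟨⟨s(w, v), hf⟩, Finset.mem_univ _, ?_⟩⟩
    rw [hval]
    exact_mod_cast ha

end EdgePairs

/-- The symmetric matrix `H̃` indexed by edges of `K_n`, with off-diagonal `(i,j)` entry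
the number of spanning trees of `K_n` containing both edges `i, j` and diagonal `0`, is
Lorentzian: exactly one eigenvalue is positive and the remaining `C(n,2) - 1` are
negative. -/
theorem stmt_9 (n : ℕ) (hn : 3 ≤ n) :
    let H : Matrix {e : Sym2 (Fin n) // ¬ e.IsDiag} {e : Sym2 (Fin n) // ¬ e.IsDiag} ℝ :=
      Matrix.of fun e f => if e = f then 0 else
        ({T : SimpleGraph (Fin n) | T.IsTree ∧ e.1 ∈ T.edgeSet ∧ f.1 ∈ T.edgeSet}.ncard : ℝ)
    ∃ hH : H.IsHermitian,
      {i | 0 < hH.eigenvalues i}.ncard = 1 ∧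
      {i | hH.eigenvalues i < 0}.ncard = Nat.choose n 2 - 1 := by
  intro H
  refine ⟨spanningTreePairMatrix_isHermitian, ?_⟩
  have h := spanningTreePairMatrix_lorentzian (V := Fin n) (by simpa using! hn)
  rwa [Fintype.card_fin] at h
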